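/- arXiv:2510.24557 — 9 statements merged into one kernel-verified Lean document; each statement's English description precedes it below -/
import Mathlib

section
/- Weight functions are a Kronecker delta with vanishing derivative on the boundary: Let M ≥ 1 and let ψ₁, …, ψ_M : ℝ² → ℝ all be differentiable at a point x ∈ ℝ². Let ĩ be an index with ψ_ĩ(x) = 0, Fréchet derivative of ψ_ĩ at x equal to 0, and ψ_j(x) > 0 for all j ≠ ĩ. Then for every i ∈ {1,…,M}, the weight function w_i is differentiable at x with w_ĩ(x) = 1, w_i(x) = 0 for i ≠ ĩ, and the Fréchet derivative of w_i at x is the zero map. -/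
/-- Weight functions are a Kronecker delta with vanishing derivative on the boundary. -/
theorem weight_functions_kronecker_delta_vanishing_derivative
    {M : ℕ} (hM : 1 ≤ M)
    (ψ : Fin M → EuclideanSpace ℝ (Fin 2) → ℝ)
    (x : EuclideanSpace ℝ (Fin 2))
    (hψ : ∀ j, DifferentiableAt ℝ (ψ j) x)
    (i₀ : Fin M)
    (h0 : ψ i₀ x = 0) (hd0 : fderiv ℝ (ψ i₀) x = 0)
    (hpos : ∀ j, j ≠ i₀ → 0 < ψ j x)
    (w : Fin M → EuclideanSpace ℝ (Fin 2) → ℝ)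
    (hw : ∀ i y, w i y =
      (∏ j ∈ Finset.univ.erase i, ψ j y) /
        ∑ k, ∏ j ∈ Finset.univ.erase k, ψ j y) :
    (∀ i, DifferentiableAt ℝ (w i) x) ∧
    w i₀ x = 1 ∧ (∀ i, i ≠ i₀ → w i x = 0) ∧
    (∀ i, fderiv ℝ (w i) x = 0) := by
  have hPd : ∀ k, DifferentiableAt ℝ (fun y => ∏ j ∈ Finset.univ.erase k, ψ j y) x := by
    intro k
    exact (HasFDerivAt.finsetProd (fun j _ => (hψ j).hasFDerivAt)).differentiableAt
  have hP0 : ∀ k, k ≠ i₀ → ∏ j ∈ Finset.univ.erase k, ψ j x = 0 := by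
    intro k hk
    exact Finset.prod_eq_zero (Finset.mem_erase.2 ⟨hk.symm, Finset.mem_univ _⟩) h0
  have hψ0 : HasFDerivAt (ψ i₀) (0 : EuclideanSpace ℝ (Fin 2) →L[ℝ] ℝ) x := by
    rw [← hd0]; exact (hψ i₀).hasFDerivAt
  have hPD : ∀ k, k ≠ i₀ → HasFDerivAt (fun y => ∏ j ∈ Finset.univ.erase k, ψ j y)
      (0 : EuclideanSpace ℝ (Fin 2) →L[ℝ] ℝ) x := by
    intro k hk
    have hQ : DifferentiableAt ℝ
        (fun y => ∏ j ∈ (Finset.univ.erase k).erase i₀, ψ j y) x :=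
      (HasFDerivAt.finsetProd (fun j _ => (hψ j).hasFDerivAt)).differentiableAt
    have h := hψ0.mul hQ.hasFDerivAt
    have he : (fun y => ∏ j ∈ Finset.univ.erase k, ψ j y) =
        ψ i₀ * (fun y => ∏ j ∈ (Finset.univ.erase k).erase i₀, ψ j y) := by
      funext y
      exact (Finset.mul_prod_erase _ (fun j => ψ j y)
        (Finset.mem_erase.2 ⟨hk.symm, Finset.mem_univ _⟩)).symm
    rw [he]
    simpa [h0] using h
  have hpp : 0 < ∏ j ∈ Finset.univ.erase i₀, ψ j x :=
    Finset.prod_pos (fun j hj => hpos j (Finset.ne_of_mem_erase hj))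
  have hS : ∑ k, ∏ j ∈ Finset.univ.erase k, ψ j x = ∏ j ∈ Finset.univ.erase i₀, ψ j x :=
    Finset.sum_eq_single i₀ (fun k _ hk => hP0 k hk) (by simp)
  have hSD : HasFDerivAt (fun y => ∑ k, ∏ j ∈ Finset.univ.erase k, ψ j y)
      (fderiv ℝ (fun y => ∏ j ∈ Finset.univ.erase i₀, ψ j y) x) x := by
    have h := HasFDerivAt.fun_sum (u := Finset.univ) (fun k _ => (hPd k).hasFDerivAt)
    rwa [Finset.sum_eq_single i₀ (fun k _ hk => (hPD k hk).fderiv) (by simp)] at h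
  have hmain : ∀ i, HasFDerivAt (w i) (0 : EuclideanSpace ℝ (Fin 2) →L[ℝ] ℝ) x := by
    intro i
    have hwi : w i = fun y => (∏ j ∈ Finset.univ.erase i, ψ j y) /
        ∑ k, ∏ j ∈ Finset.univ.erase k, ψ j y := funext (hw i)
    have h := (hPd i).hasFDerivAt.mul ((hasDerivAt_inv (by rw [hS]; exact hpp.ne')).comp_hasFDerivAt x hSD)
    rw [hwi]
    simp only [div_eq_mul_inv]
    refine HasFDerivAt.congr_fderiv h ?_
    by_cases hi : i = i₀
    · subst hi
      simp only [Function.comp_apply, hS]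
      rw [smul_smul, ← add_smul]
      have hne := hpp.ne'
      have hz : ∀ a : ℝ, a ≠ 0 → a * -(a ^ 2)⁻¹ + a⁻¹ = 0 := by
        intro a ha
        field_simp
        ring
      rw [hz _ hne, zero_smul]
    · rw [hP0 i hi, (hPD i hi).fderiv, zero_smul, smul_zero, add_zero]
  refine ⟨fun i => (hmain i).differentiableAt, ?_, ?_, fun i => (hmain i).fderiv⟩
  · rw [hw, hS, div_self hpp.ne']
  · intro i hi
    rw [hw, hP0 i hi, zero_div]
end

section
/- Proposition (system case, derivative part): Let n ≥ 1, M ≥ 1, x ∈ ℝ², and v ∈ ℝ² a direction (the outward normal in the paper). Let ψ₁, …, ψ_M : ℝ² → ℝ be differentiable at x, and let ĩ be an index with ψ_ĩ(x) = 0, Fréchet derivative of ψ_ĩ at x equal to 0, and ψ_j(x) > 0 for j ≠ ĩ. Let u₁, …, u_M, Ψ : ℝ² → ℝⁿ be differentiable at x, let b^{(1)}, …, b^{(n)} : ℝ² → ℝⁿ be differentiable at x and satisfy ⟨b^{(j)}(y), b^{(k)}(y)⟩ = δ_{jk} for all j, k and all y in some open neighborhood of x, and suppose there are functions u_ĩ^{(1)},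 …, u_ĩ^{(n)} : ℝ² → ℝ, differentiable at x, with u_ĩ(y) = ∑_{k=1}^n u_ĩ^{(k)}(y) · b^{(k)}(y) for all y in that neighborhood. Then for every j̃ ∈ {1,…,n}, the directional derivative along v at x of the function y ↦ ⟨b^{(j̃)}(y), u(y)⟩, where u(y) = ∑_{i=1}^M w_i(y) u_i(y) + (∏_{j=1}^M ψ_j(y)) · Ψ(y), equals the directional derivative of u_ĩ^{(j̃)} along v at x. -/
open scoped RealInnerProductSpace

/-- Proposition (system case, derivative part): on a boundary segment where
`ψ i₀` has value 0 and vanishing gradient, the directional derivative of the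
`j₀`-th component of the solution structure equals that of the local component. -/
theorem solution_structure_system_derivative_part
    {n M : ℕ} (hn : 1 ≤ n) (hM : 1 ≤ M)
    (x v : EuclideanSpace ℝ (Fin 2))
    (ψ : Fin M → EuclideanSpace ℝ (Fin 2) → ℝ)
    (hψ : ∀ j, DifferentiableAt ℝ (ψ j) x)
    (i₀ : Fin M)
    (h0 : ψ i₀ x = 0) (hd0 : fderiv ℝ (ψ i₀) x = 0)
    (hpos : ∀ j, j ≠ i₀ → 0 < ψ j x)
    (u : Fin M → EuclideanSpace ℝ (Fin 2) → EuclideanSpace ℝ (Fin n))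
    (hu : ∀ i, DifferentiableAt ℝ (u i) x)
    (Ψ : EuclideanSpace ℝ (Fin 2) → EuclideanSpace ℝ (Fin n))
    (hΨ : DifferentiableAt ℝ Ψ x)
    (b : Fin n → EuclideanSpace ℝ (Fin 2) → EuclideanSpace ℝ (Fin n))
    (hb : ∀ j, DifferentiableAt ℝ (b j) x)
    (s : Set (EuclideanSpace ℝ (Fin 2))) (hs : s ∈ nhds x)
    (hortho : ∀ y ∈ s, ∀ j k, ⟪b j y, b k y⟫ = if j = k then (1 : ℝ) else 0)
    (uc : Fin n → EuclideanSpace ℝ (Fin 2) → ℝ)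
    (huc : ∀ k, DifferentiableAt ℝ (uc k) x)
    (hrep : ∀ y ∈ s, u i₀ y = ∑ k, uc k y • b k y)
    (w : Fin M → EuclideanSpace ℝ (Fin 2) → ℝ)
    (hw : ∀ i y, w i y =
      (∏ j ∈ Finset.univ.erase i, ψ j y) /
        ∑ k, ∏ j ∈ Finset.univ.erase k, ψ j y)
    (U : EuclideanSpace ℝ (Fin 2) → EuclideanSpace ℝ (Fin n))
    (hU : ∀ y, U y = (∑ i, w i y • u i y) + (∏ j, ψ j y) • Ψ y) :
    ∀ j₀ : Fin n,
      fderiv ℝ (fun y => ⟪b j₀ y, U y⟫) x v = fderiv ℝ (uc j₀) x v := by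
  intro j₀
  classical
  have hprod : ∀ t : Finset (Fin M), DifferentiableAt ℝ (fun y => ∏ j ∈ t, ψ j y) x := by
    intro t
    induction t using Finset.induction_on with
    | empty => simp
    | insert a t ha ih =>
      simp only [Finset.prod_insert ha]
      exact (hψ a).fun_mul ih
  have hD : DifferentiableAt ℝ (fun y => ∑ k, ∏ j ∈ Finset.univ.erase k, ψ j y) x :=
    DifferentiableAt.fun_sum (fun k _ => hprod _)
  have hDx : (∑ k, ∏ j ∈ Finset.univ.erase k, ψ j x) ≠ 0 := by
    rw [Finset.sum_eq_single i₀]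
    · exact (Finset.prod_pos (fun j hj => hpos j (Finset.ne_of_mem_erase hj))).ne'
    · intro k _ hk
      exact Finset.prod_eq_zero (Finset.mem_erase.2 ⟨hk.symm, Finset.mem_univ _⟩) h0
    · simp
  let R : EuclideanSpace ℝ (Fin 2) → EuclideanSpace ℝ (Fin n) := fun y =>
    (∑ i ∈ Finset.univ.erase i₀,
      ((∏ j ∈ (Finset.univ.erase i).erase i₀, ψ j y) /
        ∑ k, ∏ j ∈ Finset.univ.erase k, ψ j y) • (u i y - u i₀ y))
      + (∏ j ∈ Finset.univ.erase i₀, ψ j y) • Ψ y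
  have hR : DifferentiableAt ℝ R x := by
    refine DifferentiableAt.fun_add (DifferentiableAt.fun_sum fun i _ => ?_) ((hprod _).fun_smul hΨ)
    simp only [div_eq_mul_inv]
    exact ((hprod _).fun_mul (hD.fun_inv hDx)).fun_smul ((hu i).fun_sub (hu i₀))
  have hg : DifferentiableAt ℝ (fun y => ⟪b j₀ y, R y⟫) x := (hb j₀).inner ℝ hR
  have hev : (fun y => ⟪b j₀ y, U y⟫) =ᶠ[nhds x]
      fun y => uc j₀ y + ψ i₀ y * ⟪b j₀ y, R y⟫ := by
    filter_upwards [hs, hD.continuousAt.eventually_ne hDx] with y hy hDy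
    have hw1 : ∑ i, w i y = 1 := by
      simp only [hw]
      rw [← Finset.sum_div, div_self hDy]
    have hwi : ∀ i ∈ Finset.univ.erase i₀, w i y = ψ i₀ y *
        ((∏ j ∈ (Finset.univ.erase i).erase i₀, ψ j y) /
          ∑ k, ∏ j ∈ Finset.univ.erase k, ψ j y) := by
      intro i hi
      rw [hw, ← mul_div_assoc, Finset.mul_prod_erase _ (fun j => ψ j y)]
      exact Finset.mem_erase.2 ⟨(Finset.ne_of_mem_erase hi).symm, Finset.mem_univ _⟩
    have hUy : U y = u i₀ y + ψ i₀ y • R y := by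
      have e1 : ∑ i, w i y • u i y = u i₀ y + ∑ i, w i y • (u i y - u i₀ y) := by
        simp only [smul_sub, Finset.sum_sub_distrib]
        rw [← Finset.sum_smul, hw1, one_smul]
        abel
      have e2 : ∑ i, w i y • (u i y - u i₀ y)
          = ∑ i ∈ Finset.univ.erase i₀, w i y • (u i y - u i₀ y) := by
        rw [← Finset.add_sum_erase _ _ (Finset.mem_univ i₀)]
        simp
      rw [hU, e1, e2, Finset.sum_congr rfl (fun i hi => by rw [hwi i hi, mul_smul]),
        ← Finset.smul_sum, ← Finset.mul_prod_erase _ (fun j => ψ j y) (Finset.mem_univ i₀), mul_smul,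
        add_assoc, ← smul_add]
    have hin : ⟪b j₀ y, u i₀ y⟫ = uc j₀ y := by
      rw [hrep y hy, inner_sum]
      simp [inner_smul_right, hortho y hy]
    rw [hUy, inner_add_right, hin, inner_smul_right]
  rw [hev.fderiv_eq, fderiv_fun_add (huc j₀) ((hψ i₀).fun_mul hg), fderiv_fun_mul (hψ i₀) hg, h0, hd0]
  simp
end

section
/- The boundary-value term of the GLSS local solution structure has zero normal derivative: Let x ∈ ℝ² and let n ∈ ℝ² be a unit vector. Let φ̄, Ψ : ℝ² → ℝ be differentiable on a neighborhood of x with gradient maps y ↦ ∇φ̄(y) and y ↦ ∇Ψ(y) differentiable at x, and suppose φ̄(x) = 0 and ∇φ̄(x) = −n. Then the function y ↦ Ψ(y) − φ̄(y)·⟨∇φ̄(y), ∇Ψ(y)⟩ has directional derivative 0 along n at x (and takes the value Ψ(x) at x). -/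
open scoped RealInnerProductSpace

/-- The boundary-value term of the GLSS local solution structure has zero normal
derivative and attains the value `Ψ x` at the boundary point `x`. -/
theorem glss_boundary_value_term_zero_normal_derivative
    (x n : EuclideanSpace ℝ (Fin 2)) (hn : ‖n‖ = 1)
    (φ Ψ : EuclideanSpace ℝ (Fin 2) → ℝ)
    (s : Set (EuclideanSpace ℝ (Fin 2))) (hs : s ∈ nhds x)
    (hφdiff : ∀ y ∈ s, DifferentiableAt ℝ φ y)
    (hΨdiff : ∀ y ∈ s, DifferentiableAt ℝ Ψ y)
    (hφgrad : DifferentiableAt ℝ (gradient φ) x)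
    (hΨgrad : DifferentiableAt ℝ (gradient Ψ) x)
    (hφ0 : φ x = 0) (hφn : gradient φ x = -n) :
    (Ψ x - φ x * ⟪gradient φ x, gradient Ψ x⟫ = Ψ x) ∧
    fderiv ℝ (fun y => Ψ y - φ y * ⟪gradient φ y, gradient Ψ y⟫) x n = 0 := by
  refine ⟨by rw [hφ0]; ring, ?_⟩
  have hx := mem_of_mem_nhds hs
  have h1 := (hφdiff x hx).hasGradientAt.hasFDerivAt
  have h2 := (hΨdiff x hx).hasGradientAt.hasFDerivAt
  have h3 : DifferentiableAt ℝ (fun y => ⟪gradient φ y, gradient Ψ y⟫) x :=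
    hφgrad.inner ℝ hΨgrad
  have h4 := h2.sub (h1.mul h3.hasFDerivAt)
  have h5 : fderiv ℝ (fun y => Ψ y - φ y * ⟪gradient φ y, gradient Ψ y⟫) x = _ := h4.fderiv
  rw [h5]
  simp [hφ0, hφn, hn, real_inner_comm]
end

section
/- The scalar GLSS solution structure satisfies the Robin boundary condition pointwise: Let x ∈ ℝ² and let n ∈ ℝ² be a unit vector. Let φ : ℝ² → ℝ and Ψ₁ : ℝ² → ℝ be differentiable on a neighborhood of x with gradient maps differentiable at x, suppose φ(x) = 0 and ∇φ(x) = −n, and let c, h, Ψ₂ : ℝ² → ℝ be differentiable at x. Define u(y) = Ψ₁(y) − φ(y)·⟨∇φ(y), ∇Ψ₁(y)⟩ + φ(y)·(c(y)·Ψ₁(y) − h(y)) + φ(y)²·Ψ₂(y). Then u(x) = Ψ₁(x) and the directional derivative of u along n at x satisfies ∂u/∂n(x) + c(x)·u(x) = h(x). -/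
open scoped RealInnerProductSpace

/-- The scalar GLSS solution structure satisfies the Robin boundary condition
pointwise at a boundary point `x` with unit outward normal `n`. -/
theorem glss_scalar_solution_structure_satisfies_robin
    (x n : EuclideanSpace ℝ (Fin 2)) (hn : ‖n‖ = 1)
    (φ Ψ₁ : EuclideanSpace ℝ (Fin 2) → ℝ)
    (s : Set (EuclideanSpace ℝ (Fin 2))) (hs : s ∈ nhds x)
    (hφdiff : ∀ y ∈ s, DifferentiableAt ℝ φ y)
    (hΨ₁diff : ∀ y ∈ s, DifferentiableAt ℝ Ψ₁ y)
    (hφgrad : DifferentiableAt ℝ (gradient φ) x)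
    (hΨ₁grad : DifferentiableAt ℝ (gradient Ψ₁) x)
    (hφ0 : φ x = 0) (hφn : gradient φ x = -n)
    (c h Ψ₂ : EuclideanSpace ℝ (Fin 2) → ℝ)
    (hc : DifferentiableAt ℝ c x) (hh : DifferentiableAt ℝ h x)
    (hΨ₂ : DifferentiableAt ℝ Ψ₂ x)
    (u : EuclideanSpace ℝ (Fin 2) → ℝ)
    (hu : ∀ y, u y = Ψ₁ y - φ y * ⟪gradient φ y, gradient Ψ₁ y⟫
        + φ y * (c y * Ψ₁ y - h y) + (φ y) ^ 2 * Ψ₂ y) :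
    u x = Ψ₁ x ∧ fderiv ℝ u x n + c x * u x = h x := by
  have hxs : x ∈ s := mem_of_mem_nhds hs
  have hφx := hφdiff x hxs
  have hΨx := hΨ₁diff x hxs
  have hux : u x = Ψ₁ x := by rw [hu, hφ0]; ring
  refine ⟨hux, ?_⟩
  have hgrad : ∀ f : EuclideanSpace ℝ (Fin 2) → ℝ, fderiv ℝ f x n = ⟪gradient f x, n⟫ := by
    intro f
    simp [gradient]
  have hφd : fderiv ℝ φ x n = -1 := by
    rw [hgrad, hφn, inner_neg_left, real_inner_self_eq_norm_sq, hn]; norm_num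
  -- write `u = Ψ₁ + φ * g`
  let g : EuclideanSpace ℝ (Fin 2) → ℝ := fun y =>
    -⟪gradient φ y, gradient Ψ₁ y⟫ + (c y * Ψ₁ y - h y) + φ y * Ψ₂ y
  have hg : DifferentiableAt ℝ g x :=
    (((hφgrad.inner ℝ hΨ₁grad).neg).add ((hc.mul hΨx).sub hh)).add (hφx.mul hΨ₂)
  have hueq : u = fun y => Ψ₁ y + φ y * g y := by
    funext y
    rw [hu]
    simp only [g]
    ring
  have hgx : g x = fderiv ℝ Ψ₁ x n + (c x * Ψ₁ x - h x) := by
    simp only [g]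
    rw [hgrad, hφ0, hφn, inner_neg_left, real_inner_comm n]
    ring
  have hd : HasFDerivAt u (fderiv ℝ Ψ₁ x + (φ x • fderiv ℝ g x + g x • fderiv ℝ φ x)) x := by
    rw [hueq]
    exact hΨx.hasFDerivAt.add (hφx.hasFDerivAt.mul hg.hasFDerivAt)
  rw [hd.fderiv, hux]
  simp only [add_apply, smul_apply, smul_eq_mul, hφ0, hφd, hgx]
  ring
end

section
/- The normalizer of a function is constant in the normal direction at the boundary: Let x ∈ ℝ² and let n ∈ ℝ² be a unit vector. Let φ̄ : ℝ² → ℝ be differentiable on a neighborhood of x with gradient map differentiable at x, with φ̄(x) = 0 and ∇φ̄(x) = −n, and let f : ℝ² → ℝ be differentiable at x. Define N(y) = y − φ̄(y)·∇φ̄(y). Then f(N(x)) = f(x) and the composition y ↦ f(N(y)) has directional derivative 0 along n at x. -/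
open scoped RealInnerProductSpace

/-- The normalizer of a function is constant in the normal direction at the
boundary: `f ∘ N` agrees with `f` at the boundary point and has vanishing
directional derivative along the unit outward normal there. -/
theorem normalizer_of_function_constant_in_normal_direction
    (x n : EuclideanSpace ℝ (Fin 2)) (hn : ‖n‖ = 1)
    (φ : EuclideanSpace ℝ (Fin 2) → ℝ)
    (s : Set (EuclideanSpace ℝ (Fin 2))) (hs : s ∈ nhds x)
    (hφdiff : ∀ y ∈ s, DifferentiableAt ℝ φ y)
    (hφgrad : DifferentiableAt ℝ (gradient φ) x)
    (hφ0 : φ x = 0) (hφn : gradient φ x = -n)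
    (f : EuclideanSpace ℝ (Fin 2) → ℝ)
    (hf : DifferentiableAt ℝ f x)
    (N : EuclideanSpace ℝ (Fin 2) → EuclideanSpace ℝ (Fin 2))
    (hN : ∀ y, N y = y - φ y • gradient φ y) :
    f (N x) = f x ∧ fderiv ℝ (fun y => f (N y)) x n = 0 := by
  have hφx : DifferentiableAt ℝ φ x := hφdiff x (mem_of_mem_nhds hs)
  have hNx : N x = x := by rw [hN, hφ0]; simp
  refine ⟨by rw [hNx], ?_⟩
  have hg : HasFDerivAt φ (InnerProductSpace.toDual ℝ _ (-n)) x := by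
    rw [← hφn]
    exact hφx.hasGradientAt.hasFDerivAt
  have hD := (hasFDerivAt_id (𝕜 := ℝ) x).sub (hg.smul hφgrad.hasFDerivAt)
  have hNe : N = fun y => y - φ y • gradient φ y := funext hN
  have hNe2 : (id - φ • gradient φ) = N := by
    rw [hNe]
    rfl
  have hD2 := hD
  rw [hNe2] at hD2
  have hf' : HasFDerivAt f (fderiv ℝ f x) (N x) := by
    rw [hNx]
    exact hf.hasFDerivAt
  have hc := hf'.comp x hD2
  have he : fderiv ℝ (fun y => f (N y)) x = _ := hc.fderiv
  rw [he]
  simp [hφ0, hφn, hn]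
end

section
/- The scalar OP (orthogonal projection) solution structure satisfies the Robin boundary condition pointwise: Let x ∈ ℝ² and let n ∈ ℝ² be a unit vector. Let φ̄ : ℝ² → ℝ be differentiable on a neighborhood of x with gradient map differentiable at x, with φ̄(x) = 0 and ∇φ̄(x) = −n, and let Ψ, c, h : ℝ² → ℝ be differentiable at x. Define N(y) = y − φ̄(y)·∇φ̄(y), f(y) = c(y)·Ψ(y) − h(y), and u(y) = Ψ(N(y)) + φ̄(y)·f(N(y)). Then u(x) = Ψ(x) and the directional derivative of u along n at x satisfies ∂u/∂n(x) + c(x)·u(x) = h(x). -/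
open scoped RealInnerProductSpace

/-- The scalar OP (orthogonal projection) solution structure satisfies the
Robin boundary condition pointwise at a boundary point `x` with unit outward
normal `n`. -/
theorem op_scalar_solution_structure_satisfies_robin
    (x n : EuclideanSpace ℝ (Fin 2)) (hn : ‖n‖ = 1)
    (φ : EuclideanSpace ℝ (Fin 2) → ℝ)
    (s : Set (EuclideanSpace ℝ (Fin 2))) (hs : s ∈ nhds x)
    (hφdiff : ∀ y ∈ s, DifferentiableAt ℝ φ y)
    (hφgrad : DifferentiableAt ℝ (gradient φ) x)
    (hφ0 : φ x = 0) (hφn : gradient φ x = -n)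
    (Ψ c h : EuclideanSpace ℝ (Fin 2) → ℝ)
    (hΨ : DifferentiableAt ℝ Ψ x) (hc : DifferentiableAt ℝ c x)
    (hh : DifferentiableAt ℝ h x)
    (N : EuclideanSpace ℝ (Fin 2) → EuclideanSpace ℝ (Fin 2))
    (hN : ∀ y, N y = y - φ y • gradient φ y)
    (f : EuclideanSpace ℝ (Fin 2) → ℝ)
    (hf : ∀ y, f y = c y * Ψ y - h y)
    (u : EuclideanSpace ℝ (Fin 2) → ℝ)
    (hu : ∀ y, u y = Ψ (N y) + φ y * f (N y)) :
    u x = Ψ x ∧ fderiv ℝ u x n + c x * u x = h x := by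
  have hNx : N x = x := by simp [hN, hφ0]
  have hux : u x = Ψ x := by rw [hu, hNx, hφ0]; ring
  have hφx : HasFDerivAt φ (fderiv ℝ φ x) x := (hφdiff x (mem_of_mem_nhds hs)).hasFDerivAt
  have hφ' : fderiv ℝ φ x n = -1 := by
    have h1 := (hφdiff x (mem_of_mem_nhds hs)).hasGradientAt.hasFDerivAt.fderiv
    rw [h1, hφn]
    simp [hn]
  have hN1 := (hasFDerivAt_id (𝕜 := ℝ) x).sub (hφx.smul hφgrad.hasFDerivAt)
  have hN2 := hN1.congr_of_eventuallyEq (f₁ := N)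
    (Filter.Eventually.of_forall fun y => by simp [hN])
  have hNd : DifferentiableAt ℝ N x := hN2.differentiableAt
  have hN' : fderiv ℝ N x n = 0 := by
    rw [hN2.fderiv]
    simp [hφ0, hφn, hφ']
  have hfd : DifferentiableAt ℝ f x := by
    rw [funext hf]; exact (hc.mul hΨ).sub hh
  have hΨN : HasFDerivAt (fun y => Ψ (N y)) ((fderiv ℝ Ψ x).comp (fderiv ℝ N x)) x := by
    refine HasFDerivAt.comp x ?_ hNd.hasFDerivAt
    rw [hNx]; exact hΨ.hasFDerivAt
  have hfN : HasFDerivAt (fun y => f (N y)) ((fderiv ℝ f x).comp (fderiv ℝ N x)) x := by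
    refine HasFDerivAt.comp x ?_ hNd.hasFDerivAt
    rw [hNx]; exact hfd.hasFDerivAt
  have hu' := (hΨN.add (hφx.mul hfN)).congr_of_eventuallyEq (f₁ := u)
    (Filter.Eventually.of_forall fun y => by simp [hu])
  refine ⟨hux, ?_⟩
  rw [hu'.fderiv, hux]
  simp [hφ0, hφ', hN', hNx, hf]
end

section
/- Theorem (Dirichlet part of the main theorem, pointwise form): Let n ≥ 1, M ≥ 1, ψ₁, …, ψ_M : ℝ² → ℝ, x ∈ ℝ², and ĩ an index with ψ_ĩ(x) = 0 and ψ_j(x) > 0 for j ≠ ĩ. Suppose b⁽¹⁾(x), …, b⁽ⁿ⁾(x) ∈ ℝⁿ form an orthonormal basis, u₁, …, u_M, Ψ : ℝ² → ℝⁿ are arbitrary, and u_ĩ(x) = ∑_{k=1}^n u_ĩ^{(k)}(x) · b^{(k)}(x) where for a fixed index j the component is given by the local Dirichlet structure u_ĩ^{(j)}(y) = g(y) + φ̄(y)·Ψ̃(y) for functions g, Ψ̃, φ̄ : ℝ² → ℝ with φ̄(x) = 0. Then the solution structure u(y) = ∑_{i=1}^M w_i(y) u_i(y) + (∏_{j=1}^M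 ψ_j(y)) · Ψ(y) satisfies the Dirichlet condition ⟨b^{(j)}(x), u(x)⟩ = g(x). -/
open scoped RealInnerProductSpace

/-- Theorem (Dirichlet part of the main theorem, pointwise form): at a point of
a Dirichlet boundary segment, the solution structure attains the prescribed
Dirichlet value `g x` in the component `b j₀`. -/
theorem solution_structure_satisfies_dirichlet_condition
    {n M : ℕ} (hn : 1 ≤ n) (hM : 1 ≤ M)
    (ψ : Fin M → EuclideanSpace ℝ (Fin 2) → ℝ)
    (x : EuclideanSpace ℝ (Fin 2)) (i₀ : Fin M)
    (h0 : ψ i₀ x = 0) (hpos : ∀ j, j ≠ i₀ → 0 < ψ j x)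
    (b : Fin n → EuclideanSpace ℝ (Fin n))
    (hb : Orthonormal ℝ b)
    (u : Fin M → EuclideanSpace ℝ (Fin 2) → EuclideanSpace ℝ (Fin n))
    (Ψ : EuclideanSpace ℝ (Fin 2) → EuclideanSpace ℝ (Fin n))
    (uc : Fin n → EuclideanSpace ℝ (Fin 2) → ℝ)
    (j₀ : Fin n)
    (g Ψt φbar : EuclideanSpace ℝ (Fin 2) → ℝ)
    (hφbar0 : φbar x = 0)
    (hloc : ∀ y, uc j₀ y = g y + φbar y * Ψt y)
    (hrep : u i₀ x = ∑ k, uc k x • b k)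
    (w : Fin M → EuclideanSpace ℝ (Fin 2) → ℝ)
    (hw : ∀ i y, w i y =
      (∏ j ∈ Finset.univ.erase i, ψ j y) /
        ∑ k, ∏ j ∈ Finset.univ.erase k, ψ j y)
    (U : EuclideanSpace ℝ (Fin 2) → EuclideanSpace ℝ (Fin n))
    (hU : ∀ y, U y = (∑ i, w i y • u i y) + (∏ j, ψ j y) • Ψ y) :
    ⟪b j₀, U x⟫ = g x := by
  have hz : ∀ k, k ≠ i₀ → ∏ j ∈ Finset.univ.erase k, ψ j x = 0 := fun k hk =>
    Finset.prod_eq_zero (Finset.mem_erase.2 ⟨hk.symm, Finset.mem_univ _⟩) h0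
  have hp : ∏ j ∈ Finset.univ.erase i₀, ψ j x ≠ 0 :=
    (Finset.prod_pos fun j hj => hpos j (Finset.ne_of_mem_erase hj)).ne'
  have hs : ∑ k, ∏ j ∈ Finset.univ.erase k, ψ j x = ∏ j ∈ Finset.univ.erase i₀, ψ j x :=
    Finset.sum_eq_single i₀ (fun k _ hk => hz k hk) (by simp)
  have hw1 : w i₀ x = 1 := by rw [hw, hs, div_self hp]
  have hw0 : ∀ i, i ≠ i₀ → w i x = 0 := fun i hi => by rw [hw, hz i hi, zero_div]
  have hsum : ∑ i, w i x • u i x = u i₀ x := by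
    rw [Finset.sum_eq_single i₀ (fun i _ hi => by rw [hw0 i hi, zero_smul]) (by simp),
      hw1, one_smul]
  have hprod : ∏ j, ψ j x = 0 := Finset.prod_eq_zero (Finset.mem_univ i₀) h0
  rw [hU, hsum, hprod, zero_smul, add_zero, hrep, hb.inner_right_fintype, hloc, hφbar0,
    zero_mul, add_zero]
end

section
/- Theorem (GLSS Robin part of the main theorem, local pointwise form): Let m ≥ 1, x ∈ ℝ², and n ∈ ℝ² a unit vector. Let φ̄ : ℝ² → ℝ be differentiable on a neighborhood of x with gradient map differentiable at x, with φ̄(x) = 0 and ∇φ̄(x) = −n. Let b^{(1)}, …, b^{(m)} : ℝ² → ℝ^m with b^{(1)}(x), …, b^{(m)}(x) an orthonormal basis, let D ⊆ {1,…,m} (the Dirichlet components), and fix ĵ ∉ D. Let Ψ^{(k)} : ℝ² → ℝ for k ∉ D, with Ψ^{(ĵ)} differentiable on a neighborhood of x with gradient map differentiable at x; let c : ℝ² → ℝ^m and h : ℝ² → ℝ be such that f(y) := ⟨c(y), ∑_{k∉D} Ψ^{(k)}(y)·b^{(k)}(y)⟩ − h(y) is differentiable at x, and suppose ⟨c(x),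 b^{(k)}(x)⟩ = 0 for every k ∈ D. Define the local component u^{(ĵ)}(y) = Ψ^{(ĵ)}(y) − φ̄(y)·⟨∇φ̄(y), ∇Ψ^{(ĵ)}(y)⟩ + φ̄(y)·f(y), let u^{(k)} : ℝ² → ℝ for k ≠ ĵ be any functions with u^{(k)}(x) = Ψ^{(k)}(x) for all k ∉ D, and set u_loc(y) = ∑_{k=1}^m u^{(k)}(y)·b^{(k)}(y). Then the directional derivative of u^{(ĵ)} along n at x satisfies ∂u^{(ĵ)}/∂n(x) + ⟨c(x), u_loc(x)⟩ = h(x). -/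
open scoped RealInnerProductSpace

/-- Theorem (GLSS Robin part of the main theorem, local pointwise form). -/
theorem glss_system_local_structure_satisfies_robin
    {m : ℕ} (hm : 1 ≤ m)
    (x n : EuclideanSpace ℝ (Fin 2)) (hn : ‖n‖ = 1)
    (φ : EuclideanSpace ℝ (Fin 2) → ℝ)
    (s : Set (EuclideanSpace ℝ (Fin 2))) (hs : s ∈ nhds x)
    (hφdiff : ∀ y ∈ s, DifferentiableAt ℝ φ y)
    (hφgrad : DifferentiableAt ℝ (gradient φ) x)
    (hφ0 : φ x = 0) (hφn : gradient φ x = -n)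
    (b : Fin m → EuclideanSpace ℝ (Fin 2) → EuclideanSpace ℝ (Fin m))
    (hb : Orthonormal ℝ (fun k => b k x))
    (D : Finset (Fin m)) (j₀ : Fin m) (hj₀ : j₀ ∉ D)
    (Ψ : Fin m → EuclideanSpace ℝ (Fin 2) → ℝ)
    (hΨdiff : ∀ y ∈ s, DifferentiableAt ℝ (Ψ j₀) y)
    (hΨgrad : DifferentiableAt ℝ (gradient (Ψ j₀)) x)
    (c : EuclideanSpace ℝ (Fin 2) → EuclideanSpace ℝ (Fin m))
    (h : EuclideanSpace ℝ (Fin 2) → ℝ)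
    (f : EuclideanSpace ℝ (Fin 2) → ℝ)
    (hf_def : ∀ y, f y = ⟪c y, ∑ k ∈ Finset.univ \ D, Ψ k y • b k y⟫ - h y)
    (hf : DifferentiableAt ℝ f x)
    (hcD : ∀ k ∈ D, ⟪c x, b k x⟫ = 0)
    (u : Fin m → EuclideanSpace ℝ (Fin 2) → ℝ)
    (hu_j₀ : ∀ y, u j₀ y = Ψ j₀ y
        - φ y * ⟪gradient φ y, gradient (Ψ j₀) y⟫ + φ y * f y)
    (hu_vals : ∀ k, k ∉ D → u k x = Ψ k x)
    (uloc : EuclideanSpace ℝ (Fin 2) → EuclideanSpace ℝ (Fin m))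
    (huloc : ∀ y, uloc y = ∑ k, u k y • b k y) :
    fderiv ℝ (u j₀) x n + ⟪c x, uloc x⟫ = h x := by
  have hxs : x ∈ s := mem_of_mem_nhds hs
  have hφx := hφdiff x hxs
  have hΨx := hΨdiff x hxs
  have hgrad : ∀ g : EuclideanSpace ℝ (Fin 2) → ℝ, ⟪gradient g x, n⟫ = fderiv ℝ g x n := by
    intro g
    unfold gradient
    exact InnerProductSpace.toDual_symm_apply
  have hφ' : fderiv ℝ φ x n = -1 := by
    rw [← hgrad, hφn, inner_neg_left, real_inner_self_eq_norm_sq, hn]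
    norm_num
  have hin : DifferentiableAt ℝ (fun y => ⟪gradient φ y, gradient (Ψ j₀) y⟫) x :=
    hφgrad.inner ℝ hΨgrad
  have hu : u j₀ = fun y => Ψ j₀ y
        - φ y * ⟪gradient φ y, gradient (Ψ j₀) y⟫ + φ y * f y := funext hu_j₀
  have hd := (hΨx.hasFDerivAt.sub (hφx.hasFDerivAt.mul hin.hasFDerivAt)).add
    (hφx.hasFDerivAt.mul hf.hasFDerivAt)
  have hd' : fderiv ℝ (u j₀) x n = - f x := by
    have hu2 : u j₀ = (Ψ j₀ - φ * fun y => ⟪gradient φ y, gradient (Ψ j₀) y⟫) + φ * f := hu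
    rw [hu2, hd.fderiv]
    simp only [ContinuousLinearMap.add_apply, ContinuousLinearMap.sub_apply,
      ContinuousLinearMap.smul_apply, smul_eq_mul, hφ0, hφ', hφn, inner_neg_left]
    rw [real_inner_comm, hgrad]
    ring
  have hc : ⟪c x, uloc x⟫ = ⟪c x, ∑ k ∈ Finset.univ \ D, Ψ k x • b k x⟫ := by
    rw [huloc, inner_sum, inner_sum]
    symm
    rw [← Finset.sum_sdiff (Finset.subset_univ D), Finset.sum_eq_zero (s := D), add_zero]
    · refine Finset.sum_congr rfl fun k hk => ?_
      rw [hu_vals k (Finset.mem_sdiff.1 hk).2]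
    · intro k hk
      rw [inner_smul_right, hcD k hk, mul_zero]
  rw [hd', hc, hf_def]
  ring
end

section
/- Theorem (OP Robin part of the main theorem, local pointwise form): Let m ≥ 1, x ∈ ℝ², and n ∈ ℝ² a unit vector. Let φ̄ : ℝ² → ℝ be differentiable on a neighborhood of x with gradient map differentiable at x, with φ̄(x) = 0 and ∇φ̄(x) = −n, and define the normalizer map N(y) = y − φ̄(y)·∇φ̄(y). Let b^{(1)}, …, b^{(m)} : ℝ² → ℝ^m with b^{(1)}(x), …, b^{(m)}(x) an orthonormal basis, let D ⊆ {1,…,m}, and fix ĵ ∉ D. Let Ψ̄^{(k)} : ℝ² → ℝ for k ∉ D, with Ψ̄^{(ĵ)} differentiable at x; let c : ℝ² → ℝ^m and h : ℝ² → ℝ be such that f(y) := ⟨c(y), ∑_{k∉D} Ψ̄^{(k)}(y)·b^{(k)}(y)⟩ − h(y) is differentiable at x, and suppose ⟨c(x), b^{(k)}(x)⟩ = 0 for every k ∈ D. Define the local component u^{(ĵ)}(y) = Ψ̄^{(ĵ)}(N(y)) + φ̄(y)·f(N(y)), let u^{(k)} : ℝ² → ℝ for k ≠ ĵ be any functions with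 u^{(k)}(x) = Ψ̄^{(k)}(x) for all k ∉ D, and set u_loc(y) = ∑_{k=1}^m u^{(k)}(y)·b^{(k)}(y). Then the directional derivative of u^{(ĵ)} along n at x satisfies ∂u^{(ĵ)}/∂n(x) + ⟨c(x), u_loc(x)⟩ = h(x). -/
open scoped RealInnerProductSpace

/-- Theorem (OP Robin part of the main theorem, local pointwise form). -/
theorem op_system_local_structure_satisfies_robin
    {m : ℕ} (hm : 1 ≤ m)
    (x n : EuclideanSpace ℝ (Fin 2)) (hn : ‖n‖ = 1)
    (φ : EuclideanSpace ℝ (Fin 2) → ℝ)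
    (s : Set (EuclideanSpace ℝ (Fin 2))) (hs : s ∈ nhds x)
    (hφdiff : ∀ y ∈ s, DifferentiableAt ℝ φ y)
    (hφgrad : DifferentiableAt ℝ (gradient φ) x)
    (hφ0 : φ x = 0) (hφn : gradient φ x = -n)
    (N : EuclideanSpace ℝ (Fin 2) → EuclideanSpace ℝ (Fin 2))
    (hN : ∀ y, N y = y - φ y • gradient φ y)
    (b : Fin m → EuclideanSpace ℝ (Fin 2) → EuclideanSpace ℝ (Fin m))
    (hb : Orthonormal ℝ (fun k => b k x))
    (D : Finset (Fin m)) (j₀ : Fin m) (hj₀ : j₀ ∉ D)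
    (Ψ : Fin m → EuclideanSpace ℝ (Fin 2) → ℝ)
    (hΨj₀ : DifferentiableAt ℝ (Ψ j₀) x)
    (c : EuclideanSpace ℝ (Fin 2) → EuclideanSpace ℝ (Fin m))
    (h : EuclideanSpace ℝ (Fin 2) → ℝ)
    (f : EuclideanSpace ℝ (Fin 2) → ℝ)
    (hf_def : ∀ y, f y = ⟪c y, ∑ k ∈ Finset.univ \ D, Ψ k y • b k y⟫ - h y)
    (hf : DifferentiableAt ℝ f x)
    (hcD : ∀ k ∈ D, ⟪c x, b k x⟫ = 0)
    (u : Fin m → EuclideanSpace ℝ (Fin 2) → ℝ)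
    (hu_j₀ : ∀ y, u j₀ y = Ψ j₀ (N y) + φ y * f (N y))
    (hu_vals : ∀ k, k ∉ D → u k x = Ψ k x)
    (uloc : EuclideanSpace ℝ (Fin 2) → EuclideanSpace ℝ (Fin m))
    (huloc : ∀ y, uloc y = ∑ k, u k y • b k y) :
    fderiv ℝ (u j₀) x n + ⟪c x, uloc x⟫ = h x := by
  have hφx : HasFDerivAt φ (fderiv ℝ φ x) x := (hφdiff x (mem_of_mem_nhds hs)).hasFDerivAt
  have hφd : fderiv ℝ φ x n = -1 := by
    have h1 : ⟪gradient φ x, n⟫ = fderiv ℝ φ x n := by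
      simp [gradient]
    rw [← h1, hφn, inner_neg_left, real_inner_self_eq_norm_sq, hn]
    norm_num
  have hNx : N x = x := by rw [hN, hφ0]; simp
  have hNfun : N = id - φ • gradient φ := funext hN
  have hNd := (hasFDerivAt_id (𝕜 := ℝ) x).sub (hφx.smul hφgrad.hasFDerivAt)
  rw [← hNfun] at hNd
  obtain ⟨N', hN', hN'n⟩ : ∃ N' : EuclideanSpace ℝ (Fin 2) →L[ℝ] EuclideanSpace ℝ (Fin 2),
      HasFDerivAt N N' x ∧ N' n = 0 := by
    refine ⟨_, hNd, ?_⟩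
    simp [hφ0, hφd, hφn]
  have hΨ' : HasFDerivAt (Ψ j₀) (fderiv ℝ (Ψ j₀) x) (N x) := by
    rw [hNx]; exact hΨj₀.hasFDerivAt
  have hf' : HasFDerivAt f (fderiv ℝ f x) (N x) := by
    rw [hNx]; exact hf.hasFDerivAt
  have hu := (hΨ'.comp x hN').add (hφx.mul (hf'.comp x hN'))
  have hufun : u j₀ = (Ψ j₀ ∘ N) + φ * (f ∘ N) := funext hu_j₀
  have hud : fderiv ℝ (u j₀) x n = - f x := by
    rw [hufun, hu.fderiv]
    simp [hφ0, hφd, hN'n, hNx]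
  have hc : ⟪c x, uloc x⟫ = ⟪c x, ∑ k ∈ Finset.univ \ D, Ψ k x • b k x⟫ := by
    rw [huloc, inner_sum, inner_sum, ← Finset.sum_sdiff (Finset.subset_univ D)]
    rw [Finset.sum_eq_zero (s := D), add_zero]
    · refine Finset.sum_congr rfl fun k hk => ?_
      rw [hu_vals k (Finset.mem_sdiff.1 hk).2]
    · intro k hk
      rw [inner_smul_right, hcD k hk, mul_zero]
  rw [hud, hc, hf_def]
  ring
end
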